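/- If two sequences (u_n) and (v_n) of rational numbers are each P-recursive, then the pointwise product sequence (u_n · v_n) is P-recursive. -/

import Mathlib

open Finset

/-- A sequence `u : ℕ → ℚ` is P-recursive if it satisfies a linear recurrence
with polynomial coefficients whose leading coefficient polynomial is nonzero. -/
def PRecursive (u : ℕ → ℚ) : Prop :=
  ∃ (r : ℕ) (c : ℕ → Polynomial ℚ), c r ≠ 0 ∧
    ∀ n : ℕ, ∑ i ∈ Finset.range (r + 1), (c i).eval (n : ℚ) * u (n + i) = 0

/-- Every shift of `u` is, up to a nonzero polynomial factor, a polynomial combination of the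
first `r` shifts. -/
theorem pRecursive_reduce (u : ℕ → ℚ) (r : ℕ) (c : ℕ → Polynomial ℚ) (hc : c r ≠ 0)
    (h : ∀ n : ℕ, ∑ i ∈ Finset.range (r + 1), (c i).eval (n : ℚ) * u (n + i) = 0) (k : ℕ) :
    ∃ (D : Polynomial ℚ) (a : ℕ → Polynomial ℚ), D ≠ 0 ∧
      ∀ n : ℕ, D.eval (n : ℚ) * u (n + k) =
        ∑ i ∈ Finset.range r, (a i).eval (n : ℚ) * u (n + i) := by
  have hcomp : ∀ p : Polynomial ℚ, p ≠ 0 → p.comp (Polynomial.X + 1) ≠ 0 := by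
    intro p hp h0
    apply hp
    have := congrArg (fun q : Polynomial ℚ => q.comp (Polynomial.X - 1)) h0
    simpa [Polynomial.comp_assoc] using this
  induction k with
  | zero =>
    rcases r with _ | m
    · refine ⟨c 0, fun _ => 0, hc, fun n => ?_⟩
      simpa using h n
    · refine ⟨1, fun i => if i = 0 then 1 else 0, one_ne_zero, fun n => ?_⟩
      rw [Finset.sum_range_succ']
      simp
  | succ k ih =>
    obtain ⟨D, a, hD, ha⟩ := ih
    refine ⟨c r * D.comp (Polynomial.X + 1), ?_⟩
    rcases r with _ | m
    · refine ⟨fun _ => 0, mul_ne_zero hc (hcomp D hD), fun n => ?_⟩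
      have h1 := ha (n + 1)
      rw [show n + 1 + k = n + (k + 1) by ring] at h1
      simp at h1 ⊢
      tauto
    · refine ⟨fun i => (if i = 0 then 0 else c (m + 1) * (a (i - 1)).comp (Polynomial.X + 1))
        - (a m).comp (Polynomial.X + 1) * c i, mul_ne_zero hc (hcomp D hD), fun n => ?_⟩
      have h1 := ha (n + 1)
      have h2 := h n
      rw [show n + 1 + k = n + (k + 1) by ring, Finset.sum_range_succ] at h1
      rw [Finset.sum_range_succ] at h2
      have e1 : ∑ i ∈ Finset.range (m + 1),
          ((if i = 0 then 0 else c (m + 1) * (a (i - 1)).comp (Polynomial.X + 1))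
            - (a m).comp (Polynomial.X + 1) * c i).eval (n : ℚ) * u (n + i)
          = (c (m + 1)).eval (n : ℚ) *
              ∑ i ∈ Finset.range m, (a i).eval ((n + 1 : ℕ) : ℚ) * u (n + 1 + i)
            - (a m).eval ((n + 1 : ℕ) : ℚ) *
              ∑ i ∈ Finset.range (m + 1), (c i).eval (n : ℚ) * u (n + i) := by
        simp only [Polynomial.eval_sub, sub_mul, Finset.sum_sub_distrib]
        congr 1
        · rw [Finset.sum_range_succ', Finset.mul_sum]
          simp [Polynomial.eval_comp, mul_assoc, add_assoc, add_comm, add_left_comm]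
        · rw [Finset.mul_sum]
          simp [Polynomial.eval_comp, mul_assoc]
      rw [e1]
      have e2 : (c (m + 1) * D.comp (Polynomial.X + 1)).eval (n : ℚ)
          = (c (m + 1)).eval (n : ℚ) * D.eval ((n + 1 : ℕ) : ℚ) := by
        simp [Polynomial.eval_comp]
      rw [e2, show n + (m + 1) = n + 1 + m by ring] at *
      linear_combination (c (m + 1)).eval (n : ℚ) * h1 + (a m).eval ((n + 1 : ℕ) : ℚ) * h2

/-- It suffices to find a nontrivial relation. -/
theorem pRecursive_of_relation (w : ℕ → ℚ) (N : ℕ) (c : ℕ → Polynomial ℚ)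
    (hc : ∃ i < N, c i ≠ 0)
    (h : ∀ n : ℕ, ∑ i ∈ Finset.range N, (c i).eval (n : ℚ) * w (n + i) = 0) :
    PRecursive w := by
  induction N with
  | zero => obtain ⟨i, hi, _⟩ := hc; omega
  | succ N ih =>
    by_cases h0 : c N = 0
    · apply ih
      · obtain ⟨i, hi, hne⟩ := hc
        refine ⟨i, ?_, hne⟩
        rcases Nat.lt_succ_iff_lt_or_eq.mp hi with h1 | rfl
        · exact h1
        · exact absurd h0 hne
      · intro n
        have := h n
        rw [Finset.sum_range_succ, h0] at this
        simpa using this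
    · exact ⟨N, c, h0, h⟩

theorem pRecursive_mul (u v : ℕ → ℚ) (hu : PRecursive u) (hv : PRecursive v) :
    PRecursive (fun n => u n * v n) := by
  obtain ⟨r, c, hc, h⟩ := hu
  obtain ⟨s, d, hd, h'⟩ := hv
  choose D a hD ha using pRecursive_reduce u r c hc h
  choose E b hE hb using pRecursive_reduce v s d hd h'
  let f : Fin (r * s + 1) → (Fin r × Fin s → Polynomial ℚ) :=
    fun k p => a k p.1 * b k p.2
  have hdep : ¬ LinearIndependent (Polynomial ℚ) f := by
    intro hl
    have := hl.fintype_card_le_finrank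
    simp at this
  obtain ⟨g, hg, k0, hk0⟩ := Fintype.not_linearIndependent_iff.mp hdep
  let g' : ℕ → Polynomial ℚ := fun k => if hk : k < r * s + 1 then g ⟨k, hk⟩ else 0
  have hg' : ∀ k : Fin (r * s + 1), g' k = g k := fun k => dif_pos k.2
  refine pRecursive_of_relation _ (r * s + 1) (fun k => g' k * (D k * E k))
    ⟨k0, k0.2, ?_⟩ ?_
  · exact mul_ne_zero (by rw [hg']; exact hk0) (mul_ne_zero (hD _) (hE _))
  · intro n
    rw [Finset.sum_range]
    have key : ∀ k : Fin (r * s + 1),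
        (g' k * (D k * E k)).eval (n : ℚ) * (u (n + k) * v (n + k)) =
        ∑ p : Fin r × Fin s, (g k * f k p).eval (n : ℚ) * (u (n + p.1) * v (n + p.2)) := by
      intro k
      have e : (g' k * (D k * E k)).eval (n : ℚ) * (u (n + k) * v (n + k)) =
        (g k).eval (n : ℚ) * (((D k).eval (n : ℚ) * u (n + k)) *
          ((E k).eval (n : ℚ) * v (n + k))) := by
        rw [hg']; simp only [Polynomial.eval_mul]; ring
      rw [e, ha, hb, Finset.sum_range, Finset.sum_range, Finset.sum_mul_sum,
        Fintype.sum_prod_type, Finset.mul_sum]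
      refine Finset.sum_congr rfl fun i _ => ?_
      rw [Finset.mul_sum]
      refine Finset.sum_congr rfl fun j _ => ?_
      simp only [f, Polynomial.eval_mul]; ring
    rw [Finset.sum_congr rfl fun k _ => key k, Finset.sum_comm]
    refine Finset.sum_eq_zero fun p _ => ?_
    rw [← Finset.sum_mul, ← Polynomial.eval_finsetSum]
    have := congrFun hg p
    simp only [Finset.sum_apply, Pi.smul_apply, smul_eq_mul, Pi.zero_apply] at this
    rw [this]; simp
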